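/- For every j ≥ 0, the element (𝔭^{j+2}/π̃)·L^{(j)}_ζ lies in A_j[ζ], where A_j denotes the integral closure of A in the subfield of L generated over K by C[𝔭^{j+1}]; consequently, for every n ≥ 1 and 0 ≤ j ≤ n−1, the element (𝔭^{n+1}/π̃)·L^{(j)}_ζ is integral over A[ζ]. -/

import Mathlib

open Polynomial Filter Topology

theorem HasSum.of_forall_eq {ι α : Type*} [AddCommMonoid α] [TopologicalSpace α] {f g : ι → α}
    {a : α} (hg : HasSum g a) (h : ∀ i, f i = g i) : HasSum f a := by
  rwa [funext h]

section FiniteFieldAlgebra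

variable {𝔽 L : Type*} [Field 𝔽] [Fintype 𝔽]

theorem add_pow_card_pow [Field L] [Algebra 𝔽 L] (x y : L) (m : ℕ) :
    (x + y) ^ Fintype.card 𝔽 ^ m = x ^ Fintype.card 𝔽 ^ m + y ^ Fintype.card 𝔽 ^ m := by
  induction m with
  | zero => simp
  | succ m ih =>
    have h := map_add (FiniteField.frobeniusAlgHom 𝔽 L)
      (x ^ Fintype.card 𝔽 ^ m) (y ^ Fintype.card 𝔽 ^ m)
    simp only [FiniteField.coe_frobeniusAlgHom] at h
    simp only [pow_succ, pow_mul, ih, h]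

variable [NormedField L] [Algebra 𝔽 L]

theorem norm_algebraMap_of_finite {s : 𝔽} (hs : s ≠ 0) : ‖algebraMap 𝔽 L s‖ = 1 := by
  have h := FiniteField.pow_card_sub_one_eq_one s hs
  have h2 : ‖algebraMap 𝔽 L s‖ ^ (Fintype.card 𝔽 - 1) = 1 := by
    rw [← norm_pow, ← map_pow, h, map_one, norm_one]
  have := Fintype.one_lt_card (α := 𝔽)
  exact (pow_eq_one_iff_of_nonneg (norm_nonneg _) (by omega)).1 h2

theorem norm_algebraMap_le_one (s : 𝔽) : ‖algebraMap 𝔽 L s‖ ≤ 1 := by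
  rcases eq_or_ne s 0 with rfl | hs
  · simp
  · exact (norm_algebraMap_of_finite hs).le

variable [IsUltrametricDist L]

theorem norm_aeval_eq {θ : L} (hθ : 1 < ‖θ‖) {a : 𝔽[X]} (ha : a ≠ 0) :
    ‖aeval θ a‖ = ‖θ‖ ^ a.natDegree := by
  induction hn : a.natDegree generalizing a with
  | zero =>
    rw [natDegree_eq_zero] at hn
    obtain ⟨s, rfl⟩ := hn
    simpa using norm_algebraMap_of_finite (L := L) (by simpa using ha)
  | succ n ih =>
    have hdeg : a.divX.natDegree = n := by rw [natDegree_divX_eq_natDegree_tsub_one, hn]; rfl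
    have hne : a.divX ≠ 0 := by
      intro h
      have := divX_eq_zero_iff.1 h
      rw [this, natDegree_C] at hn
      omega
    have hlead : ‖aeval θ (a.divX * X)‖ = ‖θ‖ ^ (n + 1) := by
      rw [map_mul, norm_mul, ih hne hdeg, aeval_X, pow_succ]
    have hlt : ‖aeval θ (C (a.coeff 0))‖ < ‖aeval θ (a.divX * X)‖ := by
      rw [hlead, aeval_C]
      exact (norm_algebraMap_le_one _).trans_lt (one_lt_pow₀ hθ (by omega))
    rw [← divX_mul_X_add a, map_add, IsUltrametricDist.norm_add_eq_max_of_norm_ne_norm hlt.ne',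
      max_eq_left hlt.le, hlead]

theorem aeval_ne_zero_of_one_lt_norm {θ : L} (hθ : 1 < ‖θ‖) {a : 𝔽[X]} (ha : a ≠ 0) :
    aeval θ a ≠ 0 := by
  rw [← norm_ne_zero_iff, norm_aeval_eq hθ ha]
  positivity

theorem finite_degree_lt (𝔽 : Type*) [Field 𝔽] [Fintype 𝔽] (n : ℕ) :
    {a : 𝔽[X] | a.degree < n}.Finite := by
  have : Finite (degreeLT 𝔽 n) := Finite.of_equiv _ (degreeLTEquiv 𝔽 n).toEquiv.symm
  refine (Set.toFinite ((degreeLT 𝔽 n : Submodule 𝔽 𝔽[X]) : Set 𝔽[X])).subset fun a ha => ?_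
  exact mem_degreeLT.2 ha

theorem tendsto_norm_aeval_cofinite {θ : L} (hθ : 1 < ‖θ‖) :
    Tendsto (fun a : 𝔽[X] => ‖aeval θ a‖) cofinite atTop := by
  refine tendsto_atTop.2 fun M => ?_
  obtain ⟨n, hn⟩ := pow_unbounded_of_one_lt M hθ
  refine (finite_degree_lt 𝔽 n).subset fun a ha => ?_
  by_contra hlt
  apply ha
  have hne : a ≠ 0 := by
    rintro rfl
    simp at hlt
  have hle : n ≤ a.natDegree := by
    have hlt' : ((n : ℕ) : WithBot ℕ) ≤ a.degree := not_lt.1 hlt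
    rw [degree_eq_natDegree hne] at hlt'
    exact_mod_cast hlt'
  change M ≤ ‖aeval θ a‖
  rw [norm_aeval_eq hθ hne]
  exact hn.le.trans (pow_le_pow_right₀ hθ.le hle)

theorem tendsto_inv_sub_aeval {θ w : L} (hθ : 1 < ‖θ‖) (hw : w ≠ 0) (z : L) :
    Tendsto (fun a : 𝔽[X] => (z - w * aeval θ a)⁻¹) cofinite (𝓝 0) := by
  refine tendsto_inv₀_cobounded.comp ?_
  rw [← tendsto_norm_atTop_iff_cobounded]
  have h : Tendsto (fun a : 𝔽[X] => ‖w‖ * ‖aeval θ a‖ - ‖z‖) cofinite atTop :=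
    tendsto_atTop_add_const_right _ _
      ((tendsto_norm_aeval_cofinite hθ).const_mul_atTop (norm_pos_iff.2 hw))
  refine tendsto_atTop_mono (fun a => ?_) h
  rw [← norm_mul, norm_sub_rev]
  exact norm_sub_norm_le _ _

end FiniteFieldAlgebra

section CarlitzExponential

/-- A finite product `∏ (1 + h xᵢ)` agrees with `1 + h ∑ xᵢ` to second order in `h`. -/
theorem norm_prod_one_add_sub_le {L ι : Type*} [NormedField L] [IsUltrametricDist L]
    {x : ι → L} {B : ℝ} (hx : ∀ i, ‖x i‖ ≤ B) {h : L} (hh : ‖h‖ * B ≤ 1) (s : Finset ι) :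
    ‖∏ i ∈ s, (1 + h * x i) - 1 - h * ∑ i ∈ s, x i‖ ≤ (‖h‖ * B) ^ 2 := by
  classical
  induction s using Finset.induction_on with
  | empty => simp; positivity
  | insert i s hi ih =>
    have hB : 0 ≤ B := (norm_nonneg _).trans (hx i)
    set S := ∑ i ∈ s, x i
    set P := ∏ i ∈ s, (1 + h * x i)
    rw [Finset.prod_insert hi, Finset.sum_insert hi]
    have e : (1 + h * x i) * P - 1 - h * (x i + S) =
        ((P - 1 - h * S) + (h * x i) * (h * S)) + (h * x i) * (P - 1 - h * S) := by ring
    have h1 : ‖h * x i‖ ≤ ‖h‖ * B := by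
      rw [norm_mul]; exact mul_le_mul_of_nonneg_left (hx i) (norm_nonneg _)
    have h2 : ‖h * S‖ ≤ ‖h‖ * B := by
      rw [norm_mul]
      exact mul_le_mul_of_nonneg_left
        (IsUltrametricDist.norm_sum_le_of_forall_le_of_nonneg hB fun i _ => hx i) (norm_nonneg _)
    rw [e]
    refine (IsUltrametricDist.norm_add_le_max _ _).trans
      (max_le ((IsUltrametricDist.norm_add_le_max _ _).trans (max_le ih ?_)) ?_)
    · rw [norm_mul, sq]
      exact mul_le_mul h1 h2 (norm_nonneg _) (by positivity)
    · rw [norm_mul]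
      exact (mul_le_of_le_one_left (norm_nonneg _) (h1.trans hh)).trans ih

variable {𝔽 L : Type*} [Field 𝔽] [Fintype 𝔽] [NormedField L] [Algebra 𝔽 L]
  {θ : L} {D : ℕ → L} {expC : L → L}

theorem carlitzFactorial_ne_zero (hθ : 1 < ‖θ‖) {q : ℕ} (hq : 1 < q) (hD0 : D 0 = 1)
    (hDrec : ∀ m : ℕ, D (m + 1) = (θ ^ q ^ (m + 1) - θ) * D m ^ q) (m : ℕ) : D m ≠ 0 := by
  induction m with
  | zero => simp [hD0]
  | succ m ih =>
    rw [hDrec]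
    refine mul_ne_zero (sub_ne_zero.2 fun h => ?_) (pow_ne_zero _ ih)
    have h1 : ‖θ‖ ^ q ^ (m + 1) = ‖θ‖ ^ 1 := by rw [← norm_pow, h, pow_one]
    have h2 := (pow_right_injective₀ (by linarith) hθ.ne') h1
    exact (one_lt_pow₀ hq (by omega)).ne' h2

theorem carlitzExp_add
    (hexp : ∀ z : L, HasSum (fun m : ℕ => z ^ Fintype.card 𝔽 ^ m / D m) (expC z)) (x y : L) :
    expC (x + y) = expC x + expC y := by
  refine (hexp (x + y)).unique ?_
  refine ((hexp x).add (hexp y)).of_forall_eq fun m => ?_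
  rw [add_pow_card_pow, add_div]

theorem carlitzExp_algebraMap_mul
    (hexp : ∀ z : L, HasSum (fun m : ℕ => z ^ Fintype.card 𝔽 ^ m / D m) (expC z)) (s : 𝔽) (x : L) :
    expC (algebraMap 𝔽 L s * x) = algebraMap 𝔽 L s * expC x := by
  refine (hexp _).unique ?_
  refine ((hexp x).mul_left (algebraMap 𝔽 L s)).of_forall_eq fun m => ?_
  have : algebraMap 𝔽 L s ^ Fintype.card 𝔽 ^ m = algebraMap 𝔽 L s := by
    rw [← map_pow, FiniteField.pow_card_pow]
  rw [mul_pow, this, mul_div_assoc]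

theorem carlitzExp_theta_mul (hθ : 1 < ‖θ‖) (hD0 : D 0 = 1)
    (hDrec : ∀ m : ℕ, D (m + 1) = (θ ^ Fintype.card 𝔽 ^ (m + 1) - θ) * D m ^ Fintype.card 𝔽)
    (hexp : ∀ z : L, HasSum (fun m : ℕ => z ^ Fintype.card 𝔽 ^ m / D m) (expC z)) (z : L) :
    expC (θ * z) = expC z ^ Fintype.card 𝔽 + θ * expC z := by
  have hD := carlitzFactorial_ne_zero hθ (Fintype.one_lt_card (α := 𝔽)) hD0 hDrec
  have h1 : HasSum (fun m : ℕ => (z ^ Fintype.card 𝔽 ^ m / D m) ^ Fintype.card 𝔽)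
      (expC z ^ Fintype.card 𝔽) := by
    have := (hexp z).map (FiniteField.frobeniusAlgHom 𝔽 L)
      (by simpa only [FiniteField.coe_frobeniusAlgHom] using continuous_pow _)
    simpa only [FiniteField.coe_frobeniusAlgHom, Function.comp_def] using this
  have h2 := (hexp (θ * z)).sub ((hexp z).mul_left θ)
  have h3 := (hasSum_nat_add_iff' 1).2 h2
  simp only [Finset.range_one, Finset.sum_singleton, pow_zero, pow_one, hD0, div_one, sub_self,
    sub_zero] at h3
  rw [← sub_eq_iff_eq_add]
  refine h3.unique ?_
  refine h1.of_forall_eq fun m => ?_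
  have h4 := hD (m + 1)
  rw [hDrec] at h4 ⊢
  have h5 := left_ne_zero_of_mul h4
  have h6 := hD m
  rw [mul_pow, div_pow, ← pow_mul, ← pow_succ]
  field_simp

variable [IsUltrametricDist L]

omit [Algebra 𝔽 L] in
theorem exists_norm_carlitzExp_sub_le (hD0 : D 0 = 1)
    (hexp : ∀ z : L, HasSum (fun m : ℕ => z ^ Fintype.card 𝔽 ^ m / D m) (expC z)) :
    ∃ B : ℝ, ∀ h : L, ‖h‖ ≤ 1 → ‖expC h - h‖ ≤ B * ‖h‖ ^ 2 := by
  obtain ⟨B, hB⟩ := (hexp 1).summable.tendsto_cofinite_zero.norm.bddAbove_range_of_cofinite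
  have hB' : ∀ m, ‖(D m)⁻¹‖ ≤ B := fun m => by
    simpa using hB (Set.mem_range_self m)
  refine ⟨B, fun h hh => ?_⟩
  have h1 := (hasSum_nat_add_iff' 1).2 (hexp h)
  simp only [Finset.range_one, Finset.sum_singleton, pow_zero, pow_one, hD0, div_one] at h1
  have hB0 : 0 ≤ B := (norm_nonneg _).trans (hB' 0)
  rw [← h1.tsum_eq]
  refine IsUltrametricDist.norm_tsum_le_of_forall_le_of_nonneg (by positivity) fun m => ?_
  rw [div_eq_inv_mul, norm_mul, norm_pow]
  refine mul_le_mul (hB' _) (pow_le_pow_of_le_one (norm_nonneg _) hh ?_) (by positivity) hB0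
  have h2 := Fintype.one_lt_card (α := 𝔽)
  calc 2 ≤ Fintype.card 𝔽 := h2
    _ ≤ Fintype.card 𝔽 ^ (m + 1) := Nat.le_self_pow (by omega) _

/-- The logarithmic derivative of the product expansion of the Carlitz exponential. -/
theorem hasSum_inv_sub_period [CompleteSpace L] (hθ : 1 < ‖θ‖) (hD0 : D 0 = 1)
    (hexp : ∀ z : L, HasSum (fun m : ℕ => z ^ Fintype.card 𝔽 ^ m / D m) (expC z))
    {w : L} (hw : w ≠ 0)
    (hprod : ∀ z : L, ∃ P : L,
      HasProd (fun a : {a : 𝔽[X] // a ≠ 0} => 1 - z / (w * aeval θ a.1)) P ∧ expC z = z * P)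
    {z : L} (hz : ∀ a : 𝔽[X], z ≠ w * aeval θ a) :
    HasSum (fun a : 𝔽[X] => (z - w * aeval θ a)⁻¹) (expC z)⁻¹ := by
  classical
  set x : 𝔽[X] → L := fun a => (z - w * aeval θ a)⁻¹ with hx
  have hx0 := tendsto_inv_sub_aeval (𝔽 := 𝔽) hθ hw z
  obtain ⟨S, hS⟩ := NonarchimedeanAddGroup.summable_of_tendsto_cofinite_zero hx0
  obtain ⟨B, hB⟩ := hx0.norm.bddAbove_range_of_cofinite
  have hB' : ∀ a, ‖x a‖ ≤ B := fun a => hB (Set.mem_range_self a)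
  have hB0 : 0 ≤ B := (norm_nonneg _).trans (hB' 0)
  obtain ⟨B₂, hB₂⟩ := exists_norm_carlitzExp_sub_le (𝔽 := 𝔽) hD0 hexp
  -- finite truncations of the product
  let F : Finset {a : 𝔽[X] // a ≠ 0} → L → L :=
    fun s y => y * ∏ a ∈ s, (1 - y / (w * aeval θ a.1))
  have hF : ∀ y, Tendsto (fun s => F s y) atTop (𝓝 (expC y)) := fun y => by
    obtain ⟨P, hP, he⟩ := hprod y
    rw [he]
    exact Tendsto.const_mul y hP
  let t : Finset {a : 𝔽[X] // a ≠ 0} → Finset 𝔽[X] :=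
    fun s => insert 0 (s.map (Function.Embedding.subtype _))
  have ht : Tendsto t atTop atTop := by
    refine tendsto_atTop.2 fun u => ?_
    filter_upwards [eventually_ge_atTop (u.subtype (· ≠ 0))] with s hs a ha
    by_cases h0 : a = 0
    · simp [t, h0]
    · exact Finset.mem_insert_of_mem (Finset.mem_map.2
        ⟨⟨a, h0⟩, hs (Finset.mem_subtype.2 ha), rfl⟩)
  have hFt : ∀ s h, F s (z + h) = F s z * ∏ a ∈ t s, (1 + h * x a) := fun s h => by
    have hz0 : z ≠ 0 := by simpa using hz 0
    rw [Finset.prod_insert (by simp), Finset.prod_map]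
    have key : ∀ a ∈ s, 1 - (z + h) / (w * aeval θ a.1) =
        (1 - z / (w * aeval θ a.1)) * (1 + h * x a.1) := fun a _ => by
      have h1 : w * aeval θ a.1 ≠ 0 := mul_ne_zero hw (aeval_ne_zero_of_one_lt_norm hθ a.2)
      have h2 := sub_ne_zero.2 (hz a.1)
      simp only [hx]
      generalize w * aeval θ a.1 = l at *
      field_simp
      ring
    simp only [F]
    rw [Finset.prod_congr rfl key, Finset.prod_mul_distrib]
    simp only [Function.Embedding.coe_subtype, hx, map_zero, mul_zero, sub_zero]
    field_simp
  -- second order estimate for `expC`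
  have hest : ∀ h : L, ‖h‖ * B ≤ 1 →
      ‖expC (z + h) - expC z - expC z * (h * S)‖ ≤ ‖expC z‖ * (‖h‖ * B) ^ 2 := fun h hh => by
    have hl : Tendsto (fun s => ‖F s (z + h) - F s z - F s z * (h * ∑ a ∈ t s, x a)‖) atTop
        (𝓝 ‖expC (z + h) - expC z - expC z * (h * S)‖) :=
      (((hF _).sub (hF z)).sub ((hF z).mul (Tendsto.const_mul h (Tendsto.comp hS ht)))).norm
    refine le_of_tendsto_of_tendsto' hl ((hF z).norm.mul_const _) fun s => ?_
    have e : F s (z + h) - F s z - F s z * (h * ∑ a ∈ t s, x a) =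
        F s z * (∏ a ∈ t s, (1 + h * x a) - 1 - h * ∑ a ∈ t s, x a) := by
      rw [hFt]; ring
    rw [e, norm_mul]
    exact mul_le_mul_of_nonneg_left (norm_prod_one_add_sub_le hB' hh _) (norm_nonneg _)
  have hlin : ∀ h : L, ‖h‖ ≤ 1 → ‖h‖ * B ≤ 1 → h ≠ 0 →
      ‖1 - expC z * S‖ ≤ ‖h‖ * (B₂ + ‖expC z‖ * B ^ 2) := fun h h1 h2 h3 => by
    have hpos : 0 < ‖h‖ := norm_pos_iff.2 h3
    have e : h * (1 - expC z * S) =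
        (expC (z + h) - expC z - expC z * (h * S)) - (expC h - h) := by
      rw [carlitzExp_add hexp]; ring
    have h4 : ‖h‖ * ‖1 - expC z * S‖ ≤ ‖h‖ * (‖h‖ * (B₂ + ‖expC z‖ * B ^ 2)) := by
      rw [← norm_mul, e]
      refine (norm_sub_le _ _).trans ((add_le_add (hest h h2) (hB₂ h h1)).trans (le_of_eq ?_))
      ring
    exact le_of_mul_le_mul_left h4 hpos
  have hθ0 : θ ≠ 0 := norm_pos_iff.1 (by linarith)
  have hpow : Tendsto (fun n : ℕ => ‖(θ⁻¹) ^ n‖) atTop (𝓝 0) := by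
    simp only [norm_pow, norm_inv]
    exact tendsto_pow_atTop_nhds_zero_of_lt_one (by positivity) (inv_lt_one_of_one_lt₀ hθ)
  have hzero : ‖1 - expC z * S‖ ≤ 0 := by
    have hlim : Tendsto (fun n : ℕ => ‖(θ⁻¹) ^ n‖ * (B₂ + ‖expC z‖ * B ^ 2)) atTop (𝓝 0) := by
      simpa using hpow.mul_const (B₂ + ‖expC z‖ * B ^ 2)
    refine ge_of_tendsto hlim ?_
    have hpowB : Tendsto (fun n : ℕ => ‖(θ⁻¹) ^ n‖ * B) atTop (𝓝 0) := by
      simpa using hpow.mul_const B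
    filter_upwards [hpow.eventually (ge_mem_nhds one_pos),
      hpowB.eventually (ge_mem_nhds one_pos)] with n h1 h2
    exact hlin _ h1 h2 (pow_ne_zero _ (inv_ne_zero hθ0))
  have hone : expC z * S = 1 := (sub_eq_zero.1 (norm_le_zero_iff.1 hzero)).symm
  rwa [← eq_inv_of_mul_eq_one_right hone]

end CarlitzExponential

section ResidueSums

variable {𝔽 L : Type*} [Field 𝔽] [NormedField L] [Algebra 𝔽 L] {θ : L}

/-- Division with remainder by a monic polynomial, as a bijection. -/
noncomputable def remainderQuotientEquiv {N : 𝔽[X]} (hN : N.Monic) :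
    degreeLT 𝔽 N.natDegree × 𝔽[X] ≃ 𝔽[X] where
  toFun x := x.1 + N * x.2
  invFun a := (⟨a %ₘ N, mem_degreeLT.2 (by
    rw [← degree_eq_natDegree hN.ne_zero]; exact degree_modByMonic_lt a hN)⟩, a /ₘ N)
  left_inv := fun ⟨⟨b, hb⟩, c⟩ => by
    have h := div_modByMonic_unique (f := b + N * c) c b hN
      ⟨rfl, by rw [degree_eq_natDegree hN.ne_zero]; exact mem_degreeLT.1 hb⟩
    simp only [h.1, h.2]
  right_inv a := modByMonic_add_div a N

variable [Fintype 𝔽] [IsUltrametricDist L]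

/-- A sum weighted by a linear form that factors through `𝔽[X] / N` is a finite combination of
inverses of `N`-torsion points of the Carlitz module. -/
theorem hasSum_div_aeval_of_periodic [CompleteSpace L] {D : ℕ → L} {expC : L → L}
    (hθ : 1 < ‖θ‖) (hD0 : D 0 = 1)
    (hexp : ∀ z : L, HasSum (fun m : ℕ => z ^ Fintype.card 𝔽 ^ m / D m) (expC z))
    {w : L} (hw : w ≠ 0)
    (hprod : ∀ z : L, ∃ P : L,
      HasProd (fun a : {a : 𝔽[X] // a ≠ 0} => 1 - z / (w * aeval θ a.1)) P ∧ expC z = z * P)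
    {N : 𝔽[X]} (hN : N.Monic) (f : 𝔽[X] →ₗ[𝔽] L) (hf : ∀ c, f (N * c) = 0)
    [Fintype (degreeLT 𝔽 N.natDegree)] :
    HasSum (fun a : 𝔽[X] => f a / aeval θ a)
      (∑ b : degreeLT 𝔽 N.natDegree,
        f b * (w / aeval θ N * (expC (w * aeval θ (b : 𝔽[X]) / aeval θ N))⁻¹)) := by
  have hfb : ∀ (b : 𝔽[X]) c, f (b + N * c) = f b := fun b c => by rw [map_add, hf, add_zero]
  have hN0 : aeval θ N ≠ 0 := aeval_ne_zero_of_one_lt_norm hθ hN.ne_zero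
  obtain ⟨B, hB⟩ := (Set.finite_range fun b : degreeLT 𝔽 N.natDegree => ‖f b‖).bddAbove
  have hbound : ∀ a, ‖f a‖ ≤ B := fun a => by
    obtain ⟨⟨b, c⟩, rfl⟩ := (remainderQuotientEquiv hN).surjective a
    change ‖f (b + N * c)‖ ≤ B
    rw [hfb]
    exact hB (Set.mem_range_self b)
  have hsummable : Summable (fun a : 𝔽[X] => f a / aeval θ a) := by
    refine NonarchimedeanAddGroup.summable_of_tendsto_cofinite_zero ?_
    have h0 := ((tendsto_inv_sub_aeval (𝔽 := 𝔽) hθ (neg_ne_zero.2 one_ne_zero) 0).norm).const_mul B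
    rw [norm_zero, mul_zero] at h0
    refine squeeze_zero_norm (fun a => ?_) h0
    rw [div_eq_mul_inv, norm_mul]
    simpa using mul_le_mul_of_nonneg_right (hbound a) (norm_nonneg (aeval θ a)⁻¹)
  obtain ⟨T, hT⟩ := hsummable
  have hfiber : ∀ b : 𝔽[X], b.degree < N.degree →
      HasSum (fun c => f (b + N * c) / aeval θ (b + N * c))
        (f b * (w / aeval θ N * (expC (w * aeval θ b / aeval θ N))⁻¹)) := fun b hlt => by
    by_cases hb0 : b = 0
    · have h0 : ∀ c, f (b + N * c) / aeval θ (b + N * c) = 0 := fun c => by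
        rw [hfb, hb0, map_zero, zero_div]
      rw [hb0, map_zero, zero_mul, ← hb0]
      exact hasSum_zero.of_forall_eq h0
    have hz : ∀ a : 𝔽[X], w * aeval θ b / aeval θ N ≠ w * aeval θ a := fun a ha => by
      rw [div_eq_iff hN0, mul_assoc, mul_right_inj' hw, ← map_mul] at ha
      have hba : b = a * N := by
        by_contra hne
        exact aeval_ne_zero_of_one_lt_norm hθ (sub_ne_zero.2 hne) (by rw [map_sub, ha, sub_self])
      exact hb0 (eq_zero_of_dvd_of_degree_lt ⟨a, by rw [hba, mul_comm]⟩ hlt)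
    have hsum := hasSum_inv_sub_period hθ hD0 hexp hw hprod hz
    rw [← (Equiv.neg 𝔽[X]).hasSum_iff] at hsum
    refine ((hsum.mul_left (w / aeval θ N)).mul_left (f b)).of_forall_eq fun c => ?_
    rw [hfb]
    simp only [Function.comp_apply, Equiv.neg_apply, map_neg, map_add, map_mul]
    have e : w * aeval θ b / aeval θ N - w * -aeval θ c =
        w / aeval θ N * (aeval θ b + aeval θ N * aeval θ c) := by
      field_simp
      ring
    rw [e, mul_inv, mul_inv_cancel_left₀ (div_ne_zero hw hN0), div_eq_mul_inv]
  have hT' := (remainderQuotientEquiv hN).hasSum_iff.2 hT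
  have hfib := hT'.prod_fiberwise fun b => hfiber b
    (by rw [degree_eq_natDegree hN.ne_zero]; exact mem_degreeLT.1 b.2)
  rwa [hfib.unique (hasSum_fintype _)] at hT

omit [IsUltrametricDist L] in
/-- Summing over nonzero polynomials instead of monic ones multiplies a linear harmonic sum
by `q - 1 = -1`. -/
theorem hasSum_monic_eq_neg (f : 𝔽[X] →ₗ[𝔽] L) {T M : L}
    (hT : HasSum (fun a : 𝔽[X] => f a / aeval θ a) T)
    (hM : HasSum (fun a : {a : 𝔽[X] // a.Monic} => f a.1 / aeval θ a.1) M) : M = -T := by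
  classical
  let g : {a : 𝔽[X] // a.Monic} × 𝔽ˣ → 𝔽[X] := fun x => C (x.2 : 𝔽) * x.1.1
  have hg : Function.Injective g := by
    rintro ⟨⟨a, ha⟩, u⟩ ⟨⟨b, hb⟩, v⟩ h
    simp only [g] at h
    have huv : (u : 𝔽) = v := by
      simpa [ha.leadingCoeff, hb.leadingCoeff] using congrArg leadingCoeff h
    rw [huv] at h
    have hab : a = b := mul_left_cancel₀ (C_ne_zero.2 v.ne_zero) h
    simp [hab, Units.ext huv]
  have hrange : ∀ a ∉ Set.range g, f a / aeval θ a = 0 := fun a ha => by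
    by_cases h0 : a = 0
    · simp [h0]
    have hl : a.leadingCoeff ≠ 0 := leadingCoeff_ne_zero.2 h0
    refine absurd ⟨(⟨C a.leadingCoeff⁻¹ * a, ?_⟩, Units.mk0 _ hl), ?_⟩ ha
    · simp [Monic, hl]
    · simp only [g, Units.val_mk0]
      rw [← mul_assoc, ← C_mul, mul_inv_cancel₀ hl, C_1, one_mul]
  have hT' := (hg.hasSum_iff hrange).2 hT
  have hcard : ((Fintype.card 𝔽ˣ : ℕ) : L) = -1 := by
    rw [Fintype.card_units, Nat.cast_sub Fintype.card_pos, Nat.cast_one,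
      ← map_natCast (algebraMap 𝔽 L), FiniteField.cast_card_eq_zero, map_zero, zero_sub]
  have hfib := hT'.prod_fiberwise (g := fun a => -(f a.1 / aeval θ a.1)) fun a => by
    have hterm : ∀ u : 𝔽ˣ, ((fun a : 𝔽[X] => f a / aeval θ a) ∘ g) (a, u) =
        f a.1 / aeval θ a.1 := fun u => by
      have hu : algebraMap 𝔽 L u ≠ 0 := by simp
      simp only [Function.comp_apply, g]
      rw [← smul_eq_C_mul, map_smul, map_smul, Algebra.smul_def, Algebra.smul_def,
        mul_div_mul_left _ _ hu]
    simp only [hterm]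
    have := hasSum_fintype fun _ : 𝔽ˣ => f a.1 / aeval θ a.1
    rwa [Finset.sum_const, Finset.card_univ, nsmul_eq_mul, hcard, neg_one_mul] at this
  rw [hfib.unique hM.neg, neg_neg]

end ResidueSums

section CarlitzTorsion

variable {𝔽 L : Type*} [Field 𝔽] [Fintype 𝔽] [Field L] [Algebra 𝔽 L] {θ : L}
  {𝔠 : 𝔽[X] → L → L}

omit [Fintype 𝔽] in
theorem aeval_mem_subring {S : Subring L} (hS : Set.range (algebraMap 𝔽 L) ⊆ S) {y : L}
    (hy : y ∈ S) (a : 𝔽[X]) : aeval y a ∈ S := by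
  rw [aeval_eq_sum_range]
  refine S.sum_mem fun i _ => ?_
  rw [Algebra.smul_def]
  exact S.mul_mem (hS ⟨_, rfl⟩) (S.pow_mem hy i)

theorem exists_carlitz_eq_mul
    (hc_add : ∀ a b : 𝔽[X], ∀ x : L, 𝔠 (a + b) x = 𝔠 a x + 𝔠 b x)
    (hc_mul : ∀ a b : 𝔽[X], ∀ x : L, 𝔠 (a * b) x = 𝔠 a (𝔠 b x))
    (hc_C : ∀ (s : 𝔽) (x : L), 𝔠 (C s) x = algebraMap 𝔽 L s * x)
    (hc_X : ∀ x : L, 𝔠 X x = x ^ Fintype.card 𝔽 + θ * x)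
    {S : Subring L} (hS : Set.range (algebraMap 𝔽 L) ⊆ S) (hθ : θ ∈ S) {x : L} (hx : x ∈ S)
    (a : 𝔽[X]) : ∃ y ∈ S, 𝔠 a x = x * (aeval θ a + x * y) := by
  induction a using Polynomial.induction_on with
  | C s => exact ⟨0, S.zero_mem, by rw [hc_C, aeval_C]; ring⟩
  | add a b ha hb =>
    obtain ⟨y, hy, ey⟩ := ha
    obtain ⟨z, hz, ez⟩ := hb
    exact ⟨y + z, S.add_mem hy hz, by rw [hc_add, ey, ez, map_add]; ring⟩
  | monomial n s ih =>
    obtain ⟨y, hy, ey⟩ := ih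
    obtain ⟨r, hr⟩ := Nat.exists_eq_add_of_le (Fintype.one_lt_card (α := 𝔽))
    have ha := aeval_mem_subring hS hθ (C s * X ^ n)
    refine ⟨x ^ r * (aeval θ (C s * X ^ n) + x * y) ^ Fintype.card 𝔽 + θ * y,
      S.add_mem (S.mul_mem (S.pow_mem hx _)
        (S.pow_mem (S.add_mem ha (S.mul_mem hx hy)) _)) (S.mul_mem hθ hy), ?_⟩
    have e : C s * X ^ (n + 1) = X * (C s * X ^ n : 𝔽[X]) := by ring
    rw [e, hc_mul, ey, hc_X, mul_pow, map_mul (aeval θ) X, aeval_X]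
    generalize aeval θ (C s * X ^ n) = u
    have hxq : x ^ Fintype.card 𝔽 = x ^ 2 * x ^ r := by rw [hr, ← pow_add]
    rw [hxq]
    ring

/-- A `P`-power torsion point of the Carlitz module divides `P`. -/
theorem aeval_mul_inv_mem_of_torsion
    (hc_add : ∀ a b : 𝔽[X], ∀ x : L, 𝔠 (a + b) x = 𝔠 a x + 𝔠 b x)
    (hc_mul : ∀ a b : 𝔽[X], ∀ x : L, 𝔠 (a * b) x = 𝔠 a (𝔠 b x))
    (hc_C : ∀ (s : 𝔽) (x : L), 𝔠 (C s) x = algebraMap 𝔽 L s * x)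
    (hc_X : ∀ x : L, 𝔠 X x = x ^ Fintype.card 𝔽 + θ * x)
    {S : Subring L} (hS : Set.range (algebraMap 𝔽 L) ⊆ S) (hθ : θ ∈ S) {P : 𝔽[X]} (m : ℕ)
    {x : L} (hx : x ∈ S) (htors : 𝔠 (P ^ m) x = 0) : aeval θ P * x⁻¹ ∈ S := by
  rcases eq_or_ne x 0 with rfl | hx0
  · simp [S.zero_mem]
  induction m with
  | zero =>
    rw [pow_zero, ← C_1, hc_C, map_one, one_mul] at htors
    exact absurd htors hx0
  | succ m ih =>
    by_cases h0 : 𝔠 (P ^ m) x = 0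
    · exact ih h0
    obtain ⟨y, hy, ey⟩ := exists_carlitz_eq_mul hc_add hc_mul hc_C hc_X hS hθ hx (P ^ m)
    have ha := aeval_mem_subring hS hθ (P ^ m)
    have hv : aeval θ (P ^ m) + x * y ∈ S := S.add_mem ha (S.mul_mem hx hy)
    have hμ : 𝔠 (P ^ m) x ∈ S := ey ▸ S.mul_mem hx hv
    obtain ⟨z, hz, ez⟩ := exists_carlitz_eq_mul hc_add hc_mul hc_C hc_X hS hθ hμ P
    rw [← hc_mul, ← pow_succ', htors, eq_comm, mul_eq_zero, or_iff_right h0] at ez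
    have e : aeval θ P * x⁻¹ = -((aeval θ (P ^ m) + x * y) * z) := by
      rw [eq_neg_of_add_eq_zero_left ez, ey]
      field_simp
    rw [e]
    exact S.neg_mem (S.mul_mem hv hz)

theorem exists_monic_aeval_eq_carlitz
    (hc_add : ∀ a b : 𝔽[X], ∀ x : L, 𝔠 (a + b) x = 𝔠 a x + 𝔠 b x)
    (hc_mul : ∀ a b : 𝔽[X], ∀ x : L, 𝔠 (a * b) x = 𝔠 a (𝔠 b x))
    (hc_C : ∀ (s : 𝔽) (x : L), 𝔠 (C s) x = algebraMap 𝔽 L s * x)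
    (hc_X : ∀ x : L, 𝔠 X x = x ^ Fintype.card 𝔽 + θ * x)
    {R : Subring L} (hR : Set.range (algebraMap 𝔽 L) ⊆ R) (hθ : θ ∈ R)
    {a : 𝔽[X]} (ha : a.Monic) :
    ∃ P : R[X], P.Monic ∧ P.natDegree = Fintype.card 𝔽 ^ a.natDegree ∧
      ∀ x : L, aeval x P = 𝔠 a x := by
  induction hn : a.natDegree generalizing a with
  | zero =>
    refine ⟨X, monic_X, by simp, fun x => ?_⟩
    rw [eq_one_of_monic_natDegree_zero ha hn, ← C_1, hc_C, map_one, one_mul, aeval_X]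
  | succ n ih =>
    have hdeg : a.divX.natDegree = n := by rw [natDegree_divX_eq_natDegree_tsub_one, hn]; rfl
    have hmon : a.divX.Monic := by
      rw [Monic, leadingCoeff, hdeg, coeff_divX, ← hn]
      exact ha
    obtain ⟨P, hP, hPdeg, hPc⟩ := ih hmon hdeg
    have hq : 1 < Fintype.card 𝔽 := Fintype.one_lt_card
    set q := Fintype.card 𝔽
    let s : R := ⟨algebraMap 𝔽 L (a.coeff 0), hR ⟨_, rfl⟩⟩
    obtain ⟨Q, hQ⟩ : ∃ Q : R[X], Q = C ⟨θ, hθ⟩ * P + C s * X := ⟨_, rfl⟩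
    have hlow : Q.natDegree ≤ q ^ n := by
      rw [hQ]
      exact natDegree_add_le_of_degree_le ((natDegree_C_mul_le _ _).trans hPdeg.le)
        ((natDegree_C_mul_le _ _).trans (natDegree_X_le.trans (Nat.one_le_pow _ _ (by omega))))
    have hpow : (P ^ q).natDegree = q ^ (n + 1) := by
      rw [hP.natDegree_pow, hPdeg, pow_succ']
    have hlt : Q.natDegree < (P ^ q).natDegree := by
      rw [hpow]
      exact hlow.trans_lt (Nat.pow_lt_pow_right hq (Nat.lt_succ_self n))
    refine ⟨P ^ q + Q, (hP.pow q).add_of_left (degree_lt_degree hlt), ?_, fun x => ?_⟩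
    · rw [natDegree_add_eq_left_of_natDegree_lt hlt, hpow]
    · have hQx : aeval x Q = θ * aeval x P + algebraMap 𝔽 L (a.coeff 0) * x := by
        rw [hQ, map_add, map_mul, map_mul, aeval_C, aeval_C, aeval_X]
        rfl
      conv_rhs => rw [← divX_mul_X_add a, mul_comm, hc_add, hc_mul, hc_X, hc_C, ← hPc]
      rw [map_add, map_pow, hQx, add_assoc]

theorem isIntegral_of_carlitz_torsion
    (hc_add : ∀ a b : 𝔽[X], ∀ x : L, 𝔠 (a + b) x = 𝔠 a x + 𝔠 b x)
    (hc_mul : ∀ a b : 𝔽[X], ∀ x : L, 𝔠 (a * b) x = 𝔠 a (𝔠 b x))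
    (hc_C : ∀ (s : 𝔽) (x : L), 𝔠 (C s) x = algebraMap 𝔽 L s * x)
    (hc_X : ∀ x : L, 𝔠 X x = x ^ Fintype.card 𝔽 + θ * x)
    {R : Subring L} (hR : Set.range (algebraMap 𝔽 L) ⊆ R) (hθ : θ ∈ R)
    {a : 𝔽[X]} (ha : a.Monic) {x : L} (hx : 𝔠 a x = 0) : IsIntegral R x := by
  obtain ⟨P, hP, -, hPc⟩ := exists_monic_aeval_eq_carlitz hc_add hc_mul hc_C hc_X hR hθ ha
  exact ⟨P, hP, (hPc x).trans hx⟩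

theorem carlitz_carlitzExp
    (hc_add : ∀ a b : 𝔽[X], ∀ x : L, 𝔠 (a + b) x = 𝔠 a x + 𝔠 b x)
    (hc_mul : ∀ a b : 𝔽[X], ∀ x : L, 𝔠 (a * b) x = 𝔠 a (𝔠 b x))
    (hc_C : ∀ (s : 𝔽) (x : L), 𝔠 (C s) x = algebraMap 𝔽 L s * x)
    (hc_X : ∀ x : L, 𝔠 X x = x ^ Fintype.card 𝔽 + θ * x)
    {expC : L → L} (hadd : ∀ x y, expC (x + y) = expC x + expC y)
    (hsmul : ∀ (s : 𝔽) x, expC (algebraMap 𝔽 L s * x) = algebraMap 𝔽 L s * expC x)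
    (htheta : ∀ z, expC (θ * z) = expC z ^ Fintype.card 𝔽 + θ * expC z) (a : 𝔽[X]) (z : L) :
    𝔠 a (expC z) = expC (aeval θ a * z) := by
  induction a using Polynomial.induction_on with
  | C s => rw [hc_C, aeval_C, hsmul]
  | add a b ha hb => rw [hc_add, ha, hb, map_add, add_mul, hadd]
  | monomial n s ih =>
    have e : C s * X ^ (n + 1) = X * (C s * X ^ n : 𝔽[X]) := by ring
    rw [e, hc_mul, ih, hc_X, map_mul (aeval θ) X, aeval_X, mul_assoc, htheta]

omit [Fintype 𝔽] in
theorem aeval_hasseDeriv_pow_succ_mul {P : 𝔽[X]} {ζ : L} (hζ : aeval ζ P = 0) (j : ℕ) (c : 𝔽[X]) :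
    aeval ζ (hasseDeriv j (P ^ (j + 1) * c)) = 0 := by
  have hmap : ∀ a : 𝔽[X], aeval ζ (hasseDeriv j a) =
      (taylor ζ (a.map (algebraMap 𝔽 L))).coeff j := fun a => by
    rw [taylor_coeff, ← eval_map_algebraMap]
    congr 1
    ext n
    simp [hasseDeriv_coeff]
  have hX : X ∣ taylor ζ (P.map (algebraMap 𝔽 L)) := by
    rw [X_dvd_iff, taylor_coeff_zero, eval_map_algebraMap, hζ]
  rw [hmap, Polynomial.map_mul, Polynomial.map_pow, taylor_mul, taylor_pow]
  exact X_pow_dvd_iff.1 ((pow_dvd_pow_of_dvd hX (j + 1)).mul_right _) j (Nat.lt_succ_self j)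

end CarlitzTorsion

theorem IsIntegral.of_subring_le {L : Type*} [CommRing L] {R S : Subring L} (h : R ≤ S) {x : L}
    (hx : IsIntegral R x) : IsIntegral S x := by
  obtain ⟨P, hP, he⟩ := hx
  refine ⟨P.map (Subring.inclusion h), hP.map _, ?_⟩
  rw [eval₂_map]
  exact he


/-- Integrality of the twisted `A`-harmonic series values.
In the Carlitz setting, let `L^{(j)}_ζ := ∑_{a monic} a_t^{(j)}(ζ)/a`.  For every
`j ≥ 0`, the element `(𝔭^{j+2}/π̃)·L^{(j)}_ζ` lies in `A_j[ζ]`, where `A_j` is the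
integral closure of `A` in the subfield of `L` generated over `K` by `C[𝔭^{j+1}]`;
consequently, for every `n ≥ 1` and `0 ≤ j ≤ n-1`, the element `(𝔭^{n+1}/π̃)·L^{(j)}_ζ`
is integral over `A[ζ]`. -/
theorem stmt_13 {L : Type*} [NormedField L] [CompleteSpace L] [IsAlgClosed L]
    (hna : IsNonarchimedean (fun x : L => ‖x‖))
    (p q κ : ℕ) (hp : p.Prime) (hκ : 0 < κ) (hq : q = p ^ κ)
    (𝔽 : Type*) [Field 𝔽] [Fintype 𝔽] [Algebra 𝔽 L] (hcard : Fintype.card 𝔽 = q)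
    (θ : L) (hθ : ‖θ‖ = q)
    (𝔠 : Polynomial 𝔽 → L → L)
    (hc_add : ∀ a b : Polynomial 𝔽, ∀ x : L, 𝔠 (a + b) x = 𝔠 a x + 𝔠 b x)
    (hc_mul : ∀ a b : Polynomial 𝔽, ∀ x : L, 𝔠 (a * b) x = 𝔠 a (𝔠 b x))
    (hc_C : ∀ (s : 𝔽) (x : L), 𝔠 (Polynomial.C s) x = algebraMap 𝔽 L s * x)
    (hc_X : ∀ x : L, 𝔠 Polynomial.X x = x ^ q + θ * x)
    (hc_lin : ∀ (a : Polynomial 𝔽) (x y : L), 𝔠 a (x + y) = 𝔠 a x + 𝔠 a y)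
    (hc_smul : ∀ (a : Polynomial 𝔽) (s : 𝔽) (x : L),
      𝔠 a (algebraMap 𝔽 L s * x) = algebraMap 𝔽 L s * 𝔠 a x)
    (D : ℕ → L) (hD0 : D 0 = 1)
    (hDrec : ∀ m : ℕ, D (m + 1) = (θ ^ q ^ (m + 1) - θ) * D m ^ q)
    (expC : L → L)
    (hexp : ∀ z : L, HasSum (fun m : ℕ => z ^ q ^ m / D m) (expC z))
    (π' : L) (hπ : π' ≠ 0)
    (hker : ∀ z : L, expC z = 0 ↔ ∃ a : Polynomial 𝔽, z = π' * Polynomial.aeval θ a)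
    (hprod : ∀ z : L, ∃ P : L,
      HasProd (fun a : {a : Polynomial 𝔽 // a ≠ 0} =>
        1 - z / (π' * Polynomial.aeval θ a.1)) P ∧ expC z = z * P)
    (d : ℕ) (hd : 0 < d)
    (𝔭 : Polynomial 𝔽) (hmonic : 𝔭.Monic) (hirr : Irreducible 𝔭)
    (hdeg : 𝔭.natDegree = d)
    (ζ : L) (hζ : Polynomial.aeval ζ 𝔭 = 0)
    (Lval : ℕ → L)
    (hL : ∀ j : ℕ,
      HasSum (fun a : {a : Polynomial 𝔽 // a.Monic} =>
        Polynomial.aeval ζ (Polynomial.hasseDeriv j a.1) / Polynomial.aeval θ a.1)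
        (Lval j)) :
    (∀ j : ℕ,
      (Polynomial.aeval θ 𝔭) ^ (j + 2) / π' * Lval j ∈ Subring.closure
        ({x : L | x ∈ Subfield.closure
            (Set.range (algebraMap 𝔽 L) ∪ {θ} ∪ {y : L | 𝔠 (𝔭 ^ (j + 1)) y = 0}) ∧
          IsIntegral (Subring.closure (Set.range (algebraMap 𝔽 L) ∪ {θ})) x} ∪ {ζ})) ∧
    ∀ n : ℕ, 1 ≤ n → ∀ j ≤ n - 1,
      IsIntegral (Subring.closure (Set.range (algebraMap 𝔽 L) ∪ {θ, ζ}))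
        ((Polynomial.aeval θ 𝔭) ^ (n + 1) / π' * Lval j) := by
  subst hcard
  have := IsUltrametricDist.isUltrametricDist_of_isNonarchimedean_norm hna
  have hθ1 : 1 < ‖θ‖ := by
    rw [hθ]
    exact_mod_cast Fintype.one_lt_card (α := 𝔽)
  have hp0 : aeval θ 𝔭 ≠ 0 := aeval_ne_zero_of_one_lt_norm hθ1 hmonic.ne_zero
  set R : Subring L := Subring.closure (Set.range (algebraMap 𝔽 L) ∪ {θ})
  have hR𝔽 : Set.range (algebraMap 𝔽 L) ⊆ R :=
    Set.subset_union_left.trans Subring.subset_closure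
  have hRθ : θ ∈ R := Subring.subset_closure (Or.inr rfl)
  have hRint : ∀ x ∈ R, IsIntegral R x := fun x hx =>
    isIntegral_algebraMap (R := R) (A := L) (x := ⟨x, hx⟩)
  have hmem : ∀ j : ℕ,
      (aeval θ 𝔭) ^ (j + 2) / π' * Lval j ∈ Subring.closure
        ({x : L | x ∈ Subfield.closure
            (Set.range (algebraMap 𝔽 L) ∪ {θ} ∪ {y : L | 𝔠 (𝔭 ^ (j + 1)) y = 0}) ∧
          IsIntegral R x} ∪ {ζ}) := fun j => by
    set E := Subfield.closure
      (Set.range (algebraMap 𝔽 L) ∪ {θ} ∪ {y : L | 𝔠 (𝔭 ^ (j + 1)) y = 0})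
    let A : Subring L := E.toSubring ⊓ (integralClosure R L).toSubring
    set T := Subring.closure ({x : L | x ∈ E ∧ IsIntegral R x} ∪ {ζ})
    have hA𝔽 : Set.range (algebraMap 𝔽 L) ⊆ A := fun x hx =>
      ⟨Subfield.subset_closure (Or.inl (Or.inl hx)), hRint x (hR𝔽 hx)⟩
    have hAθ : θ ∈ A :=
      ⟨Subfield.subset_closure (Or.inl (Or.inr rfl)), hRint θ hRθ⟩
    have hAT : A ≤ T := fun x hx => Subring.subset_closure (Or.inl hx)
    have hTζ : ζ ∈ T := Subring.subset_closure (Or.inr rfl)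
    have hN : (𝔭 ^ (j + 1)).Monic := hmonic.pow _
    have : Finite (degreeLT 𝔽 (𝔭 ^ (j + 1)).natDegree) :=
      Finite.of_equiv _ (degreeLTEquiv 𝔽 _).toEquiv.symm
    have := Fintype.ofFinite (degreeLT 𝔽 (𝔭 ^ (j + 1)).natDegree)
    let f : 𝔽[X] →ₗ[𝔽] L := (aeval ζ).toLinearMap ∘ₗ hasseDeriv j
    have hsum := hasSum_div_aeval_of_periodic hθ1 hD0 hexp hπ hprod hN f
      (aeval_hasseDeriv_pow_succ_mul hζ j)
    rw [hasSum_monic_eq_neg f hsum (hL j), mul_neg, Finset.mul_sum]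
    refine T.neg_mem (T.sum_mem fun b _ => ?_)
    set x := expC (π' * aeval θ (b : 𝔽[X]) / aeval θ (𝔭 ^ (j + 1)))
    have hx : 𝔠 (𝔭 ^ (j + 1)) x = 0 := by
      rw [carlitz_carlitzExp hc_add hc_mul hc_C hc_X (carlitzExp_add hexp)
        (carlitzExp_algebraMap_mul hexp) (carlitzExp_theta_mul hθ1 hD0 hDrec hexp),
        mul_div_cancel₀ _ (aeval_ne_zero_of_one_lt_norm hθ1 hN.ne_zero), hker]
      exact ⟨b, rfl⟩
    have hxA : x ∈ A := ⟨Subfield.subset_closure (Or.inr hx),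
      isIntegral_of_carlitz_torsion hc_add hc_mul hc_C hc_X hR𝔽 hRθ hN hx⟩
    have hdvd : aeval θ 𝔭 * x⁻¹ ∈ A :=
      aeval_mul_inv_mem_of_torsion hc_add hc_mul hc_C hc_X hA𝔽 hAθ (j + 1) hxA hx
    have e : aeval θ 𝔭 ^ (j + 2) / π' * (f b * (π' / aeval θ (𝔭 ^ (j + 1)) * x⁻¹)) =
        f b * (aeval θ 𝔭 * x⁻¹) := by
      rw [map_pow, pow_succ _ (j + 1)]
      field_simp
    rw [e]
    exact T.mul_mem (aeval_mem_subring (hA𝔽.trans hAT) hTζ _) (hAT hdvd)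
  refine ⟨hmem, fun n hn j hj => ?_⟩
  set R' : Subring L := Subring.closure (Set.range (algebraMap 𝔽 L) ∪ {θ, ζ})
  have hRR' : R ≤ R' := Subring.closure_mono (Set.union_subset_union_right _ (by simp))
  have hint : IsIntegral R' ((aeval θ 𝔭) ^ (j + 2) / π' * Lval j) := by
    have hle : Subring.closure ({x : L | x ∈ Subfield.closure
        (Set.range (algebraMap 𝔽 L) ∪ {θ} ∪ {y : L | 𝔠 (𝔭 ^ (j + 1)) y = 0}) ∧
        IsIntegral R x} ∪ {ζ}) ≤ (integralClosure R' L).toSubring := by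
      refine Subring.closure_le.2 (Set.union_subset (fun x hx => hx.2.of_subring_le hRR') ?_)
      rintro _ rfl
      exact isIntegral_algebraMap (x := (⟨_, Subring.subset_closure (by simp)⟩ : R'))
    exact hle (hmem j)
  have e : (aeval θ 𝔭) ^ (n + 1) / π' * Lval j =
      (aeval θ 𝔭) ^ (n - 1 - j) * ((aeval θ 𝔭) ^ (j + 2) / π' * Lval j) := by
    rw [← mul_assoc, ← mul_div_assoc, ← pow_add]
    congr 3
    omega
  rw [e]
  exact (isIntegral_algebraMap
    (x := (⟨_, hRR' (aeval_mem_subring hR𝔽 hRθ 𝔭)⟩ : R'))).pow _ |>.mul hint
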